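/- Let P_S and P_T be joint distributions on 𝒵 × 𝒴. Then for all classifiers F, F' : 𝒵 → 𝒴: ε_{P_T}(F) ≤ ε_{P_S}(F) + ε_{P_T}(F') + ε_{P_S}(F') + (1/2)·d_{HΔH}(P_S(Z), P_T(Z)), where d_{HΔH} is the HΔH-divergence between the 𝒵-marginals of P_S and P_T over the hypothesis class of all functions 𝒵 → 𝒴. -/

import Mathlib

open Finset

/-- Marginal on `Z` of a joint pmf on `Z × Y`. -/
noncomputable def margZ {Z Y : Type*} [Fintype Y] (P : Z × Y → ℝ) (z : Z) : ℝ :=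
  ∑ y, P (z, y)

/-- Marginal on `Y` of a joint pmf on `Z × Y`. -/
noncomputable def margY {Z Y : Type*} [Fintype Z] (P : Z × Y → ℝ) (y : Y) : ℝ :=
  ∑ z, P (z, y)

/-- Expected risk `ε_P(F) = ∑_{z : P(z)>0} P(z) ∑_y |1[y = F z] − P(y|z)|`. -/
noncomputable def risk {Z Y : Type*} [Fintype Z] [Fintype Y] [DecidableEq Y]
    (P : Z × Y → ℝ) (F : Z → Y) : ℝ :=
  ∑ z ∈ Finset.univ.filter (fun z => 0 < margZ P z),
    margZ P z * ∑ y, |(if y = F z then (1 : ℝ) else 0) - P (z, y) / margZ P z|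

/-- Disagreement of two classifiers w.r.t. a distribution on `Z`. -/
noncomputable def disag {Z : Type*} (Y : Type*) [Fintype Z] [Fintype Y] [DecidableEq Y]
    (Pz : Z → ℝ) (F₁ F₂ : Z → Y) : ℝ :=
  ∑ z, Pz z * ∑ y, |(if y = F₁ z then (1 : ℝ) else 0) - (if y = F₂ z then (1 : ℝ) else 0)|

/-- `HΔH`-divergence over the hypothesis class of all functions `Z → Y`. -/
noncomputable def dHH {Z : Type*} (Y : Type*) [Fintype Z] [Fintype Y] [DecidableEq Y]
    (P₁ P₂ : Z → ℝ) : ℝ :=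
  2 * ⨆ F₁ : Z → Y, ⨆ F₂ : Z → Y, |disag Y P₁ F₁ F₂ - disag Y P₂ F₁ F₂|

/-- Mutual information of a joint pmf on `A × B` (natural log). -/
noncomputable def MI {A B : Type*} [Fintype A] [Fintype B] (P : A × B → ℝ) : ℝ :=
  ∑ p ∈ Finset.univ.filter (fun p => 0 < P p),
    P p * Real.log (P p / ((∑ b, P (p.1, b)) * (∑ a, P (a, p.2))))

/-- Entropy of the `Y`-marginal (natural log, `0 log 0 = 0`). -/
noncomputable def entY {Z Y : Type*} [Fintype Z] [Fintype Y] (P : Z × Y → ℝ) : ℝ :=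
  -∑ y, margY P y * Real.log (margY P y)

/-- Conditionally-i.i.d. pair distribution `P⊗(z₁,z₂) = ∑_{y : P(y)>0} P(y) P(z₁|y) P(z₂|y)`. -/
noncomputable def pairDist {Z Y : Type*} [Fintype Z] [Fintype Y] (P : Z × Y → ℝ) :
    Z × Z → ℝ := fun p =>
  ∑ y ∈ Finset.univ.filter (fun y => 0 < margY P y),
    margY P y * (P (p.1, y) / margY P y) * (P (p.2, y) / margY P y)

/-- Kullback–Leibler divergence of finite pmfs (natural log). -/
noncomputable def KL {X : Type*} [Fintype X] (p q : X → ℝ) : ℝ :=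
  ∑ x ∈ Finset.univ.filter (fun x => 0 < p x), p x * Real.log (p x / q x)

/-- The risk as a sum over all of `Z`: points of zero mass contribute nothing. -/
theorem risk_eq_sum {Z Y : Type*} [Fintype Z] [Fintype Y] [DecidableEq Y]
    {P : Z × Y → ℝ} (hP : ∀ p, 0 ≤ P p) (F : Z → Y) :
    risk P F = ∑ z, margZ P z *
      ∑ y, |(if y = F z then (1 : ℝ) else 0) - P (z, y) / margZ P z| := by
  unfold risk
  refine Finset.sum_filter_of_ne fun z _ hz => ?_
  exact (Finset.sum_nonneg fun y _ => hP (z, y)).lt_of_ne' (left_ne_zero_of_mul hz)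

theorem risk_le_risk_add_disag {Z Y : Type*} [Fintype Z] [Fintype Y] [DecidableEq Y]
    {P : Z × Y → ℝ} (hP : ∀ p, 0 ≤ P p) (F F' : Z → Y) :
    risk P F ≤ risk P F' + disag Y (margZ P) F F' := by
  rw [risk_eq_sum hP, risk_eq_sum hP, disag, ← Finset.sum_add_distrib]
  refine Finset.sum_le_sum fun z _ => ?_
  rw [← mul_add, ← Finset.sum_add_distrib]
  refine mul_le_mul_of_nonneg_left (Finset.sum_le_sum fun y _ => ?_)
    (Finset.sum_nonneg fun y _ => hP (z, y))
  rw [add_comm]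
  exact abs_sub_le _ _ _

theorem disag_le_risk_add_risk {Z Y : Type*} [Fintype Z] [Fintype Y] [DecidableEq Y]
    {P : Z × Y → ℝ} (hP : ∀ p, 0 ≤ P p) (F F' : Z → Y) :
    disag Y (margZ P) F F' ≤ risk P F + risk P F' := by
  rw [risk_eq_sum hP, risk_eq_sum hP, disag, ← Finset.sum_add_distrib]
  refine Finset.sum_le_sum fun z _ => ?_
  rw [← mul_add, ← Finset.sum_add_distrib]
  refine mul_le_mul_of_nonneg_left (Finset.sum_le_sum fun y _ => ?_)
    (Finset.sum_nonneg fun y _ => hP (z, y))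
  rw [abs_sub_comm (if y = F' z then (1 : ℝ) else 0)]
  exact abs_sub_le _ _ _

theorem abs_disag_sub_disag_le_half_dHH {Z Y : Type*} [Fintype Z] [Fintype Y] [DecidableEq Y]
    (P₁ P₂ : Z → ℝ) (F₁ F₂ : Z → Y) :
    |disag Y P₁ F₁ F₂ - disag Y P₂ F₁ F₂| ≤ (1 / 2) * dHH Y P₁ P₂ := by
  have h : |disag Y P₁ F₁ F₂ - disag Y P₂ F₁ F₂| ≤
      ⨆ G₁ : Z → Y, ⨆ G₂ : Z → Y, |disag Y P₁ G₁ G₂ - disag Y P₂ G₁ G₂| :=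
    le_ciSup_of_le (Set.finite_range _).bddAbove F₁
      (le_ciSup (f := fun G₂ => |disag Y P₁ F₁ G₂ - disag Y P₂ F₁ G₂|)
        (Set.finite_range _).bddAbove F₂)
  unfold dHH
  linarith

theorem risk_triangle_dHH {Z Y : Type*} [Fintype Z] [Fintype Y] [Nonempty Z] [Nonempty Y]
    [DecidableEq Y]
    (PS PT : Z × Y → ℝ)
    (hS0 : ∀ p, 0 ≤ PS p) (hS1 : ∑ p, PS p = 1)
    (hT0 : ∀ p, 0 ≤ PT p) (hT1 : ∑ p, PT p = 1)
    (F F' : Z → Y) :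
    risk PT F ≤ risk PS F + risk PT F' + risk PS F'
      + (1 / 2) * dHH Y (margZ PS) (margZ PT) := by
  have hT := risk_le_risk_add_disag hT0 F F'
  have hS := disag_le_risk_add_risk hS0 F F'
  have hd := abs_disag_sub_disag_le_half_dHH (margZ PS) (margZ PT) F F'
  linarith [(abs_le.mp hd).1]
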